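/- arXiv:2109.01089 — 2 statements merged into one kernel-verified Lean document; each statement's English description precedes it below -/
import Mathlib

section
/- Let a₁, b₁ be reals with 0 < a₁ ≤ b₁, let (a_k, b_k) be the restriction intervals and (c⁽ᵏ⁾) the adaptivity sequence. Let n ≥ 1 and let w⁽ᵏ⁾ : Fin n → ℝ (k ≥ 0) be weight vectors such that every entry of w⁽ᵏ⁾ lies in [a_k, b_k] for all k ≥ 1 and w⁽⁰⁾ = w⁽¹⁾. Then for every k ≥ 1 and every x ∈ ℝⁿ, ‖x‖²_{w⁽ᵏ⁾} ≤ (1 + c⁽ᵏ⁾)·‖x‖²_{w⁽ᵏ⁻¹⁾} and ‖x‖²_{1/w⁽ᵏ⁾} ≤ (1 + c⁽ᵏ⁾)·‖x‖²_{1/w⁽ᵏ⁻¹⁾}. -/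
/-- Upper endpoint of the restriction interval at step `k`:
`b_k = a₁ * ((1/k²)·(b₁/a₁) + 1 − 1/k²)`. -/
noncomputable def bEnd (a₁ b₁ : ℝ) (k : ℕ) : ℝ :=
  a₁ * ((1 / (k : ℝ) ^ 2) * (b₁ / a₁) + 1 - 1 / (k : ℝ) ^ 2)

/-- Adaptivity sequence: `c⁽¹⁾ = b₁/a₁ − 1` and `c⁽ᵏ⁾ = b_{k−1}/a₁ − 1` for `k > 1`. -/
noncomputable def cSeq (a₁ b₁ : ℝ) (k : ℕ) : ℝ :=
  if k = 1 then b₁ / a₁ - 1 else bEnd a₁ b₁ (k - 1) / a₁ - 1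

/-- Weighted squared norm `‖x‖²_w = ∑ᵢ wᵢ·xᵢ²`. -/
noncomputable def wnormSq {n : ℕ} (w x : Fin n → ℝ) : ℝ := ∑ i, w i * x i ^ 2

theorem bEnd_one {a₁ : ℝ} (ha : 0 < a₁) (b₁ : ℝ) : bEnd a₁ b₁ 1 = b₁ := by
  unfold bEnd
  push_cast
  field_simp
  ring

theorem bEnd_succ_le {a₁ b₁ : ℝ} (ha : 0 < a₁) (hab : a₁ ≤ b₁) {k : ℕ} (hk : 1 ≤ k) :
    bEnd a₁ b₁ (k + 1) ≤ bEnd a₁ b₁ k := by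
  have hk' : (0 : ℝ) < k := by exact_mod_cast hk
  have hinv : 1 / ((k + 1 : ℕ) : ℝ) ^ 2 ≤ 1 / (k : ℝ) ^ 2 := by
    gcongr
    simp
  have hratio : 0 ≤ b₁ / a₁ - 1 := by
    rw [sub_nonneg, one_le_div ha]
    exact hab
  unfold bEnd
  apply mul_le_mul_of_nonneg_left _ ha.le
  linarith [mul_le_mul_of_nonneg_right hinv hratio]

theorem wnormSq_le_mul {n : ℕ} {u v : Fin n → ℝ} {c : ℝ} (h : ∀ i, u i ≤ c * v i)
    (x : Fin n → ℝ) : wnormSq u x ≤ c * wnormSq v x := by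
  unfold wnormSq
  rw [Finset.mul_sum]
  refine Finset.sum_le_sum fun i _ => ?_
  rw [← mul_assoc]
  exact mul_le_mul_of_nonneg_right (h i) (sq_nonneg _)

/-- Weights with entries in `[a, b]` are comparable, with constant `b / a`. -/
theorem wnormSq_le_of_mem_Icc {n : ℕ} {u v : Fin n → ℝ} {a b : ℝ} (ha : 0 < a)
    (hu : ∀ i, u i ∈ Set.Icc a b) (hv : ∀ i, v i ∈ Set.Icc a b) (x : Fin n → ℝ) :
    wnormSq u x ≤ b / a * wnormSq v x ∧
      wnormSq (fun i => 1 / u i) x ≤ b / a * wnormSq (fun i => 1 / v i) x := by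
  have key : ∀ {s t : ℝ}, s ∈ Set.Icc a b → t ∈ Set.Icc a b → s ≤ b / a * t := by
    intro s t hs ht
    rw [div_mul_eq_mul_div, le_div_iff₀ ha]
    exact mul_le_mul hs.2 ht.1 ha.le (ha.le.trans (hs.1.trans hs.2))
  refine ⟨wnormSq_le_mul (fun i => key (hu i) (hv i)) x, wnormSq_le_mul (fun i => ?_) x⟩
  have hui : 0 < u i := ha.trans_le (hu i).1
  have hvi : 0 < v i := ha.trans_le (hv i).1
  rw [mul_one_div, div_le_div_iff₀ hui hvi, one_mul]
  exact key (hv i) (hu i)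

/-- weighted-norm comparison for consecutive weights and their reciprocals. -/
theorem stmt3 (a₁ b₁ : ℝ) (ha : 0 < a₁) (hab : a₁ ≤ b₁)
    (n : ℕ) (hn : 1 ≤ n) (w : ℕ → Fin n → ℝ)
    (hw : ∀ k : ℕ, 1 ≤ k → ∀ i, w k i ∈ Set.Icc a₁ (bEnd a₁ b₁ k))
    (hw0 : w 0 = w 1) :
    ∀ k : ℕ, 1 ≤ k → ∀ x : Fin n → ℝ,
      wnormSq (w k) x ≤ (1 + cSeq a₁ b₁ k) * wnormSq (w (k - 1)) x ∧
      wnormSq (fun i => 1 / w k i) x ≤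
        (1 + cSeq a₁ b₁ k) * wnormSq (fun i => 1 / w (k - 1) i) x := by
  intro k hk x
  obtain rfl | ⟨m, hm, rfl⟩ : k = 1 ∨ ∃ m, 1 ≤ m ∧ k = m + 1 := by
    rcases hk.eq_or_lt with h | h
    · exact Or.inl h.symm
    · exact Or.inr ⟨k - 1, by omega, by omega⟩
  · have h1 : 1 + cSeq a₁ b₁ 1 = bEnd a₁ b₁ 1 / a₁ := by
      rw [bEnd_one ha]
      simp [cSeq]
    rw [h1, Nat.sub_self, hw0]
    exact wnormSq_le_of_mem_Icc ha (hw 1 le_rfl) (hw 1 le_rfl) x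
  · have hc : 1 + cSeq a₁ b₁ (m + 1) = bEnd a₁ b₁ m / a₁ := by
      have hm0 : m ≠ 0 := by omega
      simp [cSeq, hm0]
    rw [hc, Nat.add_sub_cancel]
    exact wnormSq_le_of_mem_Icc ha
      (fun i => Set.Icc_subset_Icc_right (bEnd_succ_le ha hab hm) (hw (m + 1) hk i)) (hw m hm) x
end

section
/- Consider the AUQ-ADMM iterates with convex functions f_j : ℝⁿ → ℝ (j = 1,…,N) and g : ℝⁿ → ℝ, with weight vectors w_j⁽ᵏ⁾ whose entries lie in the restriction intervals [a_k, b_k] (and w_j⁽⁰⁾ = w_j⁽¹⁾), and let y* = (u*, v*, λ*) be a saddle point of the consensus Lagrangian. For k ≥ 1 put λ̂_j⁽ᵏ⁾ = λ_j⁽ᵏ⁻¹⁾ + w_j⁽ᵏ⁻¹⁾ ⊙ (v⁽ᵏ⁻¹⁾ − u_j⁽ᵏ⁾) and ỹ⁽ᵏ⁾ = (u⁽ᵏ⁾, v⁽ᵏ⁾, λ̂⁽ᵏ⁾), and for i ≥ 1 let ȳⁱ = (1/i)·∑_{k=1}^i ỹ⁽ᵏ⁾ with components (ū, v̄, λ̄).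 Let C = (∑_{k=1}^∞ c⁽ᵏ⁾)·(∏_{k=1}^∞ (1 + c⁽ᵏ⁾)), which is finite. Then for every i ≥ 1: ∑_{j=1}^N f_j((1/i)∑_{k=1}^i u_j⁽ᵏ⁾) + g((1/i)∑_{k=1}^i v⁽ᵏ⁾) − (∑_{j=1}^N f_j(v*) + g(v*)) + [∑_{j=1}^N ⟨ū_j − v*, −λ̄_j⟩ + ⟨v̄ − v*, ∑_{j=1}^N λ̄_j⟩ + ∑_{j=1}^N ⟨λ̄_j − λ_j*, ū_j − v̄⟩] ≤ (‖y* − y⁽⁰⁾‖²_{T⁽⁰⁾} + C·‖y* − y⁽¹⁾‖²_{T⁽⁰⁾}) / (2i). -/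
/-- `T`-seminorm (squared) of a triple `y = (u, v, λ)` determined by the weights
`w_j`: `‖y‖²_T = ∑_j ‖v‖²_{w_j} + ∑_j ‖λ_j‖²_{1/w_j}`. -/
noncomputable def TnormSq {n N : ℕ} (w : Fin N → Fin n → ℝ)
    (v : Fin n → ℝ) (lam : Fin N → Fin n → ℝ) : ℝ :=
  (∑ j, wnormSq (w j) v) + ∑ j, wnormSq (fun i => 1 / w j i) (lam j)

/-- A convex function perturbed by a function that is quadratic along the segment from `u` to `x`
satisfies the first-order optimality condition in the direction of `x` at a minimizer `u`. -/
theorem ConvexOn.le_add_of_isMin_add_quadratic {E : Type*} [AddCommGroup E] [Module ℝ E]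
    {F φ : E → ℝ} (hF : ConvexOn ℝ Set.univ F) {u x : E} {L Q : ℝ}
    (hmin : ∀ y, F u + φ u ≤ F y + φ y)
    (hφ : ∀ t : ℝ, φ (u + t • (x - u)) = φ u + t * L + t ^ 2 * Q) :
    F u ≤ F x + L := by
  have key : ∀ t : ℝ, 0 < t → t ≤ 1 → F u ≤ F x + L + t * Q := by
    intro t ht ht1
    have hconv := hF.2 (Set.mem_univ u) (Set.mem_univ x) (sub_nonneg.2 ht1) ht.le (by ring)
    have hpt : (1 - t) • u + t • x = u + t • (x - u) := by module
    rw [hpt] at hconv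
    have hm := hmin (u + t • (x - u))
    rw [hφ] at hm
    simp only [smul_eq_mul] at hconv
    have hscaled : t * F u ≤ t * (F x + L + t * Q) := by linarith
    exact le_of_mul_le_mul_left hscaled ht
  have hlim : Filter.Tendsto (fun t : ℝ => F x + L + t * Q) (nhdsWithin 0 (Set.Ioi 0))
      (nhds (F x + L + 0 * Q)) :=
    (Continuous.tendsto (by fun_prop) 0).mono_left nhdsWithin_le_nhds
  rw [zero_mul, add_zero] at hlim
  refine ge_of_tendsto hlim ?_
  filter_upwards [Ioc_mem_nhdsGT (zero_lt_one' ℝ)] with t ht using key t ht.1 ht.2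

theorem wnormSq_add_smul {n : ℕ} (w p d : Fin n → ℝ) (t : ℝ) :
    wnormSq w (p + t • d) =
      wnormSq w p + t * (2 * ∑ i, w i * p i * d i) + t ^ 2 * wnormSq w d := by
  simp only [wnormSq, Finset.mul_sum, ← Finset.sum_add_distrib, Pi.add_apply, Pi.smul_apply,
    smul_eq_mul]
  exact Finset.sum_congr rfl fun i _ => by ring

theorem wnormSq_nonneg {n : ℕ} {w : Fin n → ℝ} (hw : ∀ i, 0 ≤ w i) (x : Fin n → ℝ) :
    0 ≤ wnormSq w x :=
  Finset.sum_nonneg fun i _ => mul_nonneg (hw i) (sq_nonneg _)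

theorem TnormSq_eq_sum {n N : ℕ} (w : Fin N → Fin n → ℝ) (v : Fin n → ℝ)
    (lam : Fin N → Fin n → ℝ) :
    TnormSq w v lam = ∑ j, ∑ i, (w j i * v i ^ 2 + 1 / w j i * lam j i ^ 2) := by
  simp only [TnormSq, wnormSq, Finset.sum_add_distrib]

theorem TnormSq_nonneg {n N : ℕ} {w : Fin N → Fin n → ℝ} (hw : ∀ j i, 0 < w j i)
    (v : Fin n → ℝ) (lam : Fin N → Fin n → ℝ) : 0 ≤ TnormSq w v lam :=
  add_nonneg (Finset.sum_nonneg fun j _ => wnormSq_nonneg (fun i => (hw j i).le) _)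
    (Finset.sum_nonneg fun j _ => wnormSq_nonneg (fun i => (one_div_pos.2 (hw j i)).le) _)

theorem TnormSq_le_mul {n N : ℕ} {w w' : Fin N → Fin n → ℝ} {r : ℝ}
    (hw : ∀ j i, 0 < w j i) (hw' : ∀ j i, 0 < w' j i)
    (h₁ : ∀ j i, w' j i ≤ r * w j i) (h₂ : ∀ j i, w j i ≤ r * w' j i)
    (v : Fin n → ℝ) (lam : Fin N → Fin n → ℝ) :
    TnormSq w' v lam ≤ r * TnormSq w v lam := by
  simp only [TnormSq_eq_sum, Finset.mul_sum]
  refine Finset.sum_le_sum fun j _ => Finset.sum_le_sum fun i _ => ?_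
  have hinv : 1 / w' j i ≤ r * (1 / w j i) := by
    rw [mul_one_div, div_le_div_iff₀ (hw' j i) (hw j i), one_mul]
    exact h₂ j i
  calc w' j i * v i ^ 2 + 1 / w' j i * lam j i ^ 2
      ≤ r * w j i * v i ^ 2 + r * (1 / w j i) * lam j i ^ 2 := by
        gcongr
        exact h₁ j i
    _ = r * (w j i * v i ^ 2 + 1 / w j i * lam j i ^ 2) := by ring

theorem bEnd_eq {a₁ b₁ : ℝ} (ha : 0 < a₁) (k : ℕ) :
    bEnd a₁ b₁ k = a₁ + (1 / (k : ℝ) ^ 2) * (b₁ - a₁) := by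
  unfold bEnd
  have h : a₁ * (b₁ / a₁) = b₁ := by field_simp
  linear_combination (1 / (k : ℝ) ^ 2) * h

theorem le_bEnd {a₁ b₁ : ℝ} (ha : 0 < a₁) (hab : a₁ ≤ b₁) (k : ℕ) : a₁ ≤ bEnd a₁ b₁ k := by
  rw [bEnd_eq ha]
  exact le_add_of_nonneg_right (mul_nonneg (by positivity) (sub_nonneg.2 hab))

theorem one_add_cSeq_succ {a₁ b₁ : ℝ} {k : ℕ} (hk : 1 ≤ k) :
    1 + cSeq a₁ b₁ (k + 1) = bEnd a₁ b₁ k / a₁ := by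
  simp [cSeq, Nat.one_le_iff_ne_zero.1 hk]

theorem cSeq_succ_nonneg {a₁ b₁ : ℝ} (ha : 0 < a₁) (hab : a₁ ≤ b₁) (k : ℕ) :
    0 ≤ cSeq a₁ b₁ (k + 1) := by
  rcases Nat.eq_zero_or_pos k with rfl | hk
  · simpa [cSeq] using (one_le_div ha).2 hab
  · have := (one_le_div ha).2 (le_bEnd ha hab k)
    linarith [one_add_cSeq_succ (a₁ := a₁) (b₁ := b₁) hk]

/-- Telescoping bound for quasi-Fejér sequences: `A k` and `B k` are the squared distances before
and after step `k`, both measured in the metric of step `k`. -/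
theorem sum_sub_le_of_quasiFejer {A B d : ℕ → ℝ} {S P : ℝ} (hd : ∀ k, 0 ≤ d k)
    (hB : ∀ k, 0 ≤ B k) (hBA : ∀ k, B k ≤ A k) (hAB : ∀ k, A (k + 1) ≤ (1 + d k) * B k)
    (hS : HasSum d S)
    (hP : Filter.Tendsto (fun m : ℕ => ∏ k ∈ Finset.range m, (1 + d k)) Filter.atTop (nhds P))
    (m : ℕ) :
    ∑ k ∈ Finset.range m, (A k - B k) ≤ A 0 + S * P * B 0 := by
  have hmono : Monotone fun m : ℕ => ∏ k ∈ Finset.range m, (1 + d k) := by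
    refine monotone_nat_of_le_succ fun m => ?_
    rw [Finset.prod_range_succ]
    exact le_mul_of_one_le_right (Finset.prod_nonneg fun k _ => by linarith [hd k])
      (by linarith [hd m])
  have hprod : ∀ k, B k ≤ (∏ l ∈ Finset.range k, (1 + d l)) * B 0 := by
    intro k
    induction k with
    | zero => simp
    | succ k ih =>
      rw [Finset.prod_range_succ]
      have := mul_le_mul_of_nonneg_left ih (by linarith [hd k] : 0 ≤ 1 + d k)
      linarith [hBA (k + 1), hAB k]
  have hPB : ∀ k, B k ≤ P * B 0 := fun k =>
    (hprod k).trans (mul_le_mul_of_nonneg_right (hmono.ge_of_tendsto hP k) (hB 0))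
  have hPB0 : 0 ≤ P * B 0 := (hB 0).trans (hPB 0)
  have htel : ∀ m, ∑ k ∈ Finset.range (m + 1), (A k - B k) ≤
      A 0 - B m + (∑ k ∈ Finset.range m, d k) * (P * B 0) := by
    intro m
    induction m with
    | zero => simp
    | succ m ih =>
      rw [Finset.sum_range_succ, Finset.sum_range_succ d]
      have := mul_le_mul_of_nonneg_left (hPB m) (hd m)
      linarith [hAB m]
  have hSP : ∀ m, (∑ k ∈ Finset.range m, d k) * (P * B 0) ≤ S * P * B 0 := fun m => by
    rw [mul_assoc]
    exact mul_le_mul_of_nonneg_right (sum_le_hasSum _ (fun k _ => hd k) hS) hPB0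
  cases m with
  | zero =>
    have := hSP 0
    simp only [Finset.range_zero, Finset.sum_empty, zero_mul] at this ⊢
    linarith [hB 0, hBA 0]
  | succ m => linarith [htel m, hSP m, hB m]

/-- Jensen's inequality for the ergodic average of the iterates `1, …, m`. -/
theorem ConvexOn.map_average_Icc_le {E : Type*} [AddCommGroup E] [Module ℝ E] {F : E → ℝ}
    (hF : ConvexOn ℝ Set.univ F) {m : ℕ} (hm : 1 ≤ m) (x : ℕ → E) :
    F ((m : ℝ)⁻¹ • ∑ k ∈ Finset.Icc 1 m, x k) ≤ (m : ℝ)⁻¹ * ∑ k ∈ Finset.Icc 1 m, F (x k) := by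
  have hm' : (m : ℝ) ≠ 0 := by exact_mod_cast Nat.one_le_iff_ne_zero.1 hm
  rw [Finset.smul_sum, Finset.mul_sum]
  exact hF.map_sum_le (w := fun _ => (m : ℝ)⁻¹) (fun _ _ => by positivity)
    (by simp [hm']) fun _ _ => Set.mem_univ _

/-- First-order optimality of the `u`-update: `λ + w ⊙ (v - u)` is a subgradient of `F` at `u`. -/
theorem ConvexOn.le_add_of_isMin_wnormSq_sub {n : ℕ} {F : (Fin n → ℝ) → ℝ}
    (hF : ConvexOn ℝ Set.univ F) {w v l u : Fin n → ℝ} (hw : ∀ i, 0 < w i)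
    (hmin : ∀ x, F u + (1 / 2) * wnormSq w (v - u + fun i => l i / w i) ≤
      F x + (1 / 2) * wnormSq w (v - x + fun i => l i / w i)) (x : Fin n → ℝ) :
    F u ≤ F x + ∑ i, (l i + w i * (v i - u i)) * (u i - x i) := by
  refine hF.le_add_of_isMin_add_quadratic
    (φ := fun x => (1 / 2) * wnormSq w (v - x + fun i => l i / w i))
    (Q := (1 / 2) * wnormSq w (u - x)) hmin fun t => ?_
  have hpt : (v - (u + t • (x - u)) + fun i => l i / w i) =
      (v - u + fun i => l i / w i) + t • (u - x) := by module
  have hL : ∑ i, w i * (v - u + fun i => l i / w i) i * (u - x) i =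
      ∑ i, (l i + w i * (v i - u i)) * (u i - x i) := by
    refine Finset.sum_congr rfl fun i _ => ?_
    have := (hw i).ne'
    simp only [Pi.add_apply, Pi.sub_apply]
    field_simp
    ring
  simp only [hpt, wnormSq_add_smul, hL]
  ring

/-- First-order optimality of the `v`-update: `-∑ⱼ (λⱼ + wⱼ ⊙ (v - uⱼ))` is a subgradient of `G`
at `v`. -/
theorem ConvexOn.le_add_of_isMin_sum_wnormSq {n N : ℕ} {G : (Fin n → ℝ) → ℝ}
    (hG : ConvexOn ℝ Set.univ G) {w l u : Fin N → Fin n → ℝ} {v : Fin n → ℝ}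
    (hw : ∀ j i, 0 < w j i)
    (hmin : ∀ z, G v + (1 / 2) * ∑ j, wnormSq (w j) (v - u j + fun i => l j i / w j i) ≤
      G z + (1 / 2) * ∑ j, wnormSq (w j) (z - u j + fun i => l j i / w j i)) (z : Fin n → ℝ) :
    G v ≤ G z + ∑ j, ∑ i, (l j i + w j i * (v i - u j i)) * (z i - v i) := by
  refine hG.le_add_of_isMin_add_quadratic
    (φ := fun z => (1 / 2) * ∑ j, wnormSq (w j) (z - u j + fun i => l j i / w j i))
    (Q := (1 / 2) * ∑ j, wnormSq (w j) (z - v)) hmin fun t => ?_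
  have hpt : ∀ j, ((v + t • (z - v)) - u j + fun i => l j i / w j i) =
      (v - u j + fun i => l j i / w j i) + t • (z - v) := fun j => by module
  have hL : ∀ j, ∑ i, w j i * (v - u j + fun i => l j i / w j i) i * (z - v) i =
      ∑ i, (l j i + w j i * (v i - u j i)) * (z i - v i) := by
    refine fun j => Finset.sum_congr rfl fun i _ => ?_
    have := (hw j i).ne'
    simp only [Pi.add_apply, Pi.sub_apply]
    field_simp
    ring
  simp only [hpt, wnormSq_add_smul, hL, Finset.sum_add_distrib, ← Finset.mul_sum]
  ring

/-- One coordinate of the energy estimate for a single step of ADMM. -/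
theorem admm_step_coord_le {w v v' u l l' vs ls : ℝ} (hw : 0 < w) (hl : l' = l + w * (v' - u)) :
    (l + w * (v - u)) * (u - vs) + l' * (vs - v') + ls * (v' - u) ≤
      ((w * (vs - v) ^ 2 + 1 / w * (ls - l) ^ 2) -
        (w * (vs - v') ^ 2 + 1 / w * (ls - l') ^ 2)) / 2 := by
  have hgap : ((w * (vs - v) ^ 2 + 1 / w * (ls - l) ^ 2) -
        (w * (vs - v') ^ 2 + 1 / w * (ls - l') ^ 2)) / 2 -
      ((l + w * (v - u)) * (u - vs) + l' * (vs - v') + ls * (v' - u)) =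
      w * (v - u) ^ 2 / 2 := by
    subst hl
    field_simp
    ring
  linarith [show 0 ≤ w * (v - u) ^ 2 / 2 by positivity]

/-- `O(1/k)` ergodic convergence rate of AUQ-ADMM. -/
theorem stmt10 (a₁ b₁ : ℝ) (ha : 0 < a₁) (hab : a₁ ≤ b₁)
    (n N : ℕ) (hn : 1 ≤ n) (hN : 1 ≤ N)
    (f : Fin N → (Fin n → ℝ) → ℝ) (g : (Fin n → ℝ) → ℝ)
    (hf : ∀ j, ConvexOn ℝ Set.univ (f j)) (hg : ConvexOn ℝ Set.univ g)
    (w : ℕ → Fin N → Fin n → ℝ)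
    (hw : ∀ k : ℕ, 1 ≤ k → ∀ j i, w k j i ∈ Set.Icc a₁ (bEnd a₁ b₁ k))
    (hw0 : w 0 = w 1)
    (u : ℕ → Fin N → Fin n → ℝ) (v : ℕ → Fin n → ℝ) (lam : ℕ → Fin N → Fin n → ℝ)
    -- u-update: `u_j⁽ᵏ⁺¹⁾` globally minimizes `f_j(u) + ½‖v⁽ᵏ⁾ − u + λ_j⁽ᵏ⁾/w_j⁽ᵏ⁾‖²_{w_j⁽ᵏ⁾}`
    (hu : ∀ (k : ℕ) (j : Fin N) (x : Fin n → ℝ),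
      f j (u (k + 1) j) +
        (1 / 2) * wnormSq (w k j) (v k - u (k + 1) j + fun i => lam k j i / w k j i) ≤
      f j x + (1 / 2) * wnormSq (w k j) (v k - x + fun i => lam k j i / w k j i))
    -- v-update: `v⁽ᵏ⁺¹⁾` globally minimizes `g(v) + ½∑_j ‖v − u_j⁽ᵏ⁺¹⁾ + λ_j⁽ᵏ⁾/w_j⁽ᵏ⁾‖²_{w_j⁽ᵏ⁾}`
    (hv : ∀ (k : ℕ) (z : Fin n → ℝ),
      g (v (k + 1)) +
        (1 / 2) * ∑ j, wnormSq (w k j)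
          (v (k + 1) - u (k + 1) j + fun i => lam k j i / w k j i) ≤
      g z + (1 / 2) * ∑ j, wnormSq (w k j)
          (z - u (k + 1) j + fun i => lam k j i / w k j i))
    -- dual update: `λ_j⁽ᵏ⁺¹⁾ = λ_j⁽ᵏ⁾ + w_j⁽ᵏ⁾ ⊙ (v⁽ᵏ⁺¹⁾ − u_j⁽ᵏ⁺¹⁾)`
    (hlam : ∀ (k : ℕ) (j : Fin N),
      lam (k + 1) j = lam k j + fun i => w k j i * (v (k + 1) i - u (k + 1) j i))
    -- saddle point
    (ustar : Fin N → Fin n → ℝ) (vstar : Fin n → ℝ) (lamstar : Fin N → Fin n → ℝ)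
    (hcons : ∀ j, ustar j = vstar)
    (hsaddle : ∀ (uu : Fin N → Fin n → ℝ) (z : Fin n → ℝ),
      (∑ j, f j (ustar j)) + g vstar ≤
        (∑ j, f j (uu j)) + g z + ∑ j, ∑ i, lamstar j i * (z i - uu j i))
    -- hatted dual variables `λ̂_j⁽ᵏ⁾ = λ_j⁽ᵏ⁻¹⁾ + w_j⁽ᵏ⁻¹⁾ ⊙ (v⁽ᵏ⁻¹⁾ − u_j⁽ᵏ⁾)`, k ≥ 1
    (lamHat : ℕ → Fin N → Fin n → ℝ)
    (hlamHat : ∀ (k : ℕ), 1 ≤ k → ∀ (j : Fin N),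
      lamHat k j = lam (k - 1) j + fun i => w (k - 1) j i * (v (k - 1) i - u k j i))
    -- the constant `C = (∑_{k=1}^∞ c⁽ᵏ⁾)·(∏_{k=1}^∞ (1 + c⁽ᵏ⁾))`, which is finite
    (S P C : ℝ)
    (hS : HasSum (fun k : ℕ => cSeq a₁ b₁ (k + 1)) S)
    (hP : Filter.Tendsto (fun m : ℕ => ∏ k ∈ Finset.range m, (1 + cSeq a₁ b₁ (k + 1)))
      Filter.atTop (nhds P))
    (hC : C = S * P) :
    ∀ m : ℕ, 1 ≤ m →
      ∀ (ubar : Fin N → Fin n → ℝ) (vbar : Fin n → ℝ) (lambar : Fin N → Fin n → ℝ),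
        (∀ j, ubar j = (m : ℝ)⁻¹ • ∑ k ∈ Finset.Icc 1 m, u k j) →
        vbar = (m : ℝ)⁻¹ • ∑ k ∈ Finset.Icc 1 m, v k →
        (∀ j, lambar j = (m : ℝ)⁻¹ • ∑ k ∈ Finset.Icc 1 m, lamHat k j) →
        (∑ j, f j (ubar j)) + g vbar - ((∑ j, f j vstar) + g vstar) +
          ((∑ j, ∑ i, (ubar j i - vstar i) * (-(lambar j i))) +
            (∑ i, (vbar i - vstar i) * (∑ j, lambar j i)) +
            ∑ j, ∑ i, (lambar j i - lamstar j i) * (ubar j i - vbar i)) ≤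
        (TnormSq (w 0) (vstar - v 0) (fun j => lamstar j - lam 0 j) +
            C * TnormSq (w 0) (vstar - v 1) (fun j => lamstar j - lam 1 j)) /
          (2 * (m : ℝ)) := by
  have hwpos : ∀ k j i, 0 < w k j i := by
    rintro (_ | k) j i
    · rw [hw0]
      exact ha.trans_le (hw 1 le_rfl j i).1
    · exact ha.trans_le (hw (k + 1) k.succ_pos j i).1
  set A : ℕ → ℝ := fun k => TnormSq (w k) (vstar - v k) (fun j => lamstar j - lam k j) with hA
  set B : ℕ → ℝ := fun k =>
    TnormSq (w k) (vstar - v (k + 1)) (fun j => lamstar j - lam (k + 1) j) with hB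
  set gap : ℕ → ℝ := fun k => (∑ j, f j (u k j)) + g (v k) - ((∑ j, f j vstar) + g vstar) +
    ∑ j, ∑ i, lamstar j i * (v k i - u k j i) with hgap
  have hgap_nonneg : ∀ k, 0 ≤ gap k := fun k => by
    have := hsaddle (u k) (v k)
    simp only [hcons] at this
    simp only [hgap]
    linarith
  have hgap_le : ∀ k, gap (k + 1) ≤ (A k - B k) / 2 := fun k => by
    have hfk : ∑ j, f j (u (k + 1) j) ≤ (∑ j, f j vstar) +
        ∑ j, ∑ i, (lam k j i + w k j i * (v k i - u (k + 1) j i)) * (u (k + 1) j i - vstar i) := by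
      rw [← Finset.sum_add_distrib]
      exact Finset.sum_le_sum fun j _ =>
        (hf j).le_add_of_isMin_wnormSq_sub (hwpos k j) (hu k j) vstar
    have hgk := hg.le_add_of_isMin_sum_wnormSq (hwpos k) (hv k) vstar
    have hcoord : ∑ j, ∑ i,
        ((lam k j i + w k j i * (v k i - u (k + 1) j i)) * (u (k + 1) j i - vstar i) +
          (lam k j i + w k j i * (v (k + 1) i - u (k + 1) j i)) * (vstar i - v (k + 1) i) +
          lamstar j i * (v (k + 1) i - u (k + 1) j i)) ≤ (A k - B k) / 2 := by
      simp only [hA, hB, TnormSq_eq_sum, ← Finset.sum_sub_distrib, Finset.sum_div]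
      refine Finset.sum_le_sum fun j _ => Finset.sum_le_sum fun i _ => ?_
      rw [hlam k j]
      exact admm_step_coord_le (hwpos k j i) rfl
    simp only [Finset.sum_add_distrib] at hcoord
    simp only [hgap]
    linarith
  have hAB : ∀ k, A (k + 1) ≤ (1 + cSeq a₁ b₁ (k + 1)) * B k := fun k => by
    have hc := cSeq_succ_nonneg ha hab k
    have hratio : ∀ j i, w (k + 1) j i ≤ (1 + cSeq a₁ b₁ (k + 1)) * w k j i ∧
        w k j i ≤ (1 + cSeq a₁ b₁ (k + 1)) * w (k + 1) j i := fun j i => by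
      rcases Nat.eq_zero_or_pos k with rfl | hk
      · rw [hw0]
        have := le_mul_of_one_le_left (hwpos 1 j i).le
          (by linarith : 1 ≤ 1 + cSeq a₁ b₁ (0 + 1))
        exact ⟨this, this⟩
      · have hr : (1 + cSeq a₁ b₁ (k + 1)) * a₁ = bEnd a₁ b₁ k := by
          rw [one_add_cSeq_succ hk]
          field_simp
        have h₁ := hw k hk j i
        have h₂ := hw (k + 1) k.succ_pos j i
        have hr₁ := mul_le_mul_of_nonneg_left h₁.1 (by linarith : 0 ≤ 1 + cSeq a₁ b₁ (k + 1))
        have hr₂ := mul_le_mul_of_nonneg_left h₂.1 (by linarith : 0 ≤ 1 + cSeq a₁ b₁ (k + 1))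
        exact ⟨by linarith [h₂.2, bEnd_succ_le ha hab hk], by linarith [h₁.2]⟩
    exact TnormSq_le_mul (hwpos k) (hwpos (k + 1)) (fun j i => (hratio j i).1)
      (fun j i => (hratio j i).2) _ _
  intro m hm ubar vbar lambar hubar hvbar _
  have hm0 : (0 : ℝ) < m := by exact_mod_cast hm
  have hsum : ∑ k ∈ Finset.range m, (A k - B k) ≤ A 0 + C * B 0 := by
    rw [hC]
    exact sum_sub_le_of_quasiFejer (cSeq_succ_nonneg ha hab)
      (fun k => TnormSq_nonneg (hwpos k) _ _)
      (fun k => by linarith [hgap_nonneg (k + 1), hgap_le k]) hAB hS hP m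
  have hgap_sum : ∑ k ∈ Finset.Icc 1 m, gap k ≤ (A 0 + C * B 0) / 2 := by
    rw [← Finset.Ico_add_one_right_eq_Icc, Finset.sum_Ico_eq_sum_range]
    calc ∑ k ∈ Finset.range (m + 1 - 1), gap (1 + k)
        ≤ ∑ k ∈ Finset.range m, (A k - B k) / 2 := by
          rw [Nat.add_sub_cancel]
          exact Finset.sum_le_sum fun k _ => add_comm k 1 ▸ hgap_le k
      _ ≤ (A 0 + C * B 0) / 2 := by
          rw [← Finset.sum_div]
          linarith
  -- the terms of the bracket that involve `lambar` cancel
  have hbracket : (∑ j, ∑ i, (ubar j i - vstar i) * (-(lambar j i))) +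
        (∑ i, (vbar i - vstar i) * (∑ j, lambar j i)) +
        ∑ j, ∑ i, (lambar j i - lamstar j i) * (ubar j i - vbar i) =
      ∑ j, ∑ i, lamstar j i * (vbar i - ubar j i) := by
    simp only [Finset.mul_sum]
    rw [Finset.sum_comm (s := (Finset.univ : Finset (Fin n)))]
    simp only [← Finset.sum_add_distrib]
    exact Finset.sum_congr rfl fun j _ => Finset.sum_congr rfl fun i _ => by ring
  have hlin : ∑ j, ∑ i, lamstar j i * (vbar i - ubar j i) =
      (m : ℝ)⁻¹ * ∑ k ∈ Finset.Icc 1 m, ∑ j, ∑ i, lamstar j i * (v k i - u k j i) := by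
    rw [Finset.sum_comm (s := Finset.Icc 1 m), Finset.mul_sum]
    refine Finset.sum_congr rfl fun j _ => ?_
    rw [Finset.sum_comm (s := Finset.Icc 1 m), Finset.mul_sum]
    refine Finset.sum_congr rfl fun i _ => ?_
    rw [hubar j, hvbar, ← Finset.mul_sum, Finset.sum_sub_distrib]
    simp only [Pi.smul_apply, Finset.sum_apply, smul_eq_mul]
    ring
  have hfbar : ∑ j, f j (ubar j) ≤ (m : ℝ)⁻¹ * ∑ k ∈ Finset.Icc 1 m, ∑ j, f j (u k j) := by
    rw [Finset.sum_comm (s := Finset.Icc 1 m), Finset.mul_sum]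
    refine Finset.sum_le_sum fun j _ => ?_
    rw [hubar j]
    exact (hf j).map_average_Icc_le hm fun k => u k j
  have hgbar : g vbar ≤ (m : ℝ)⁻¹ * ∑ k ∈ Finset.Icc 1 m, g (v k) :=
    hvbar ▸ hg.map_average_Icc_le hm v
  rw [hbracket, hlin]
  calc _ ≤ (m : ℝ)⁻¹ * ∑ k ∈ Finset.Icc 1 m, gap k := by
        simp only [hgap, Finset.sum_add_distrib, Finset.sum_sub_distrib, Finset.sum_const,
          Nat.card_Icc, Nat.add_sub_cancel, nsmul_eq_mul, mul_add, mul_sub,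
          inv_mul_cancel_left₀ hm0.ne']
        linarith
    _ ≤ (m : ℝ)⁻¹ * ((A 0 + C * B 0) / 2) := by gcongr
    _ = (A 0 + C * B 0) / (2 * (m : ℝ)) := by
        field_simp
end
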